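/- Under the network cost setting (costs f_t of local form with terms in [−1,1], graph maximum degree Δ, |V| agents), the centralized strategy π₁ = μ₀, π_{t+1} ∝ μ₀ exp(−βF_t) satisfies the regret bound Σ_{t=1}^T ℓ_t(π_t) − inf_{ν∈P(X)} Σ_{t=1}^T ℓ_t(ν) ≤ 2(β|V|(Δ+1))² ln(T+1) + |V| ln(1/θ), where θ = min_v min_a μ_{v,0}(a) and ℓ_t(ν) = β⟨ν,f_t⟩ + D(ν‖μ₀). -/

import Mathlib

open Finset Real

noncomputable def gibbs {X : Type*} [Fintype X] (μ : X → ℝ) (f : X → ℝ) : X → ℝ :=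
  fun x => μ x * Real.exp (f x) / ∑ y, μ y * Real.exp (f y)

noncomputable def klDiv {X : Type*} [Fintype X] (ν ρ : X → ℝ) : ℝ :=
  ∑ x, ν x * Real.log (ν x / ρ x)

def IsProb {X : Type*} [Fintype X] (ν : X → ℝ) : Prop :=
  (∀ x, 0 ≤ ν x) ∧ ∑ x, ν x = 1

lemma aux_hoeffding {X : Type*} [Fintype X] (p h : X → ℝ) (hp : IsProb p) (a : ℝ)
    (ha : ∀ x, |h x| ≤ a) :
    ∑ x, p x * h x + Real.log (∑ x, p x * Real.exp (- h x)) ≤ a ^ 2 / 2 := by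
  classical
  letI : MeasurableSpace X := ⊤
  let m : MeasureTheory.Measure X :=
    ∑ x, ENNReal.ofReal (p x) • MeasureTheory.Measure.dirac x
  have hint : ∀ g : X → ℝ, ∫ x, g x ∂m = ∑ x, p x * g x := by
    intro g
    rw [MeasureTheory.integral_finsetSum_measure]
    · refine Finset.sum_congr rfl fun x _ => ?_
      rw [MeasureTheory.integral_smul_measure, MeasureTheory.integral_dirac,
        ENNReal.toReal_ofReal (hp.1 x), smul_eq_mul]
    · intro x _
      exact (MeasureTheory.integrable_dirac (by simp)).smul_measure (by simp)
  haveI : MeasureTheory.IsProbabilityMeasure m := by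
    constructor
    simp only [m, MeasureTheory.Measure.finsetSum_apply, MeasureTheory.Measure.smul_apply,
      MeasureTheory.measure_univ, smul_eq_mul, mul_one]
    rw [← ENNReal.ofReal_sum_of_nonneg (fun x _ => hp.1 x), hp.2, ENNReal.ofReal_one]
  have hs := ProbabilityTheory.hasSubgaussianMGF_of_mem_Icc (μ := m) (X := h) (a := -a) (b := a)
    (measurable_from_top.aemeasurable)
    (Filter.Eventually.of_forall fun x => ⟨(abs_le.1 (ha x)).1, (abs_le.1 (ha x)).2⟩)
  have h1 := hs.mgf_le (-1)
  rw [ProbabilityTheory.mgf, hint, hint] at h1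
  set e := ∑ x, p x * h x with he
  have h2 : ∑ x, p x * Real.exp (-1 * (h x - e)) = Real.exp e * ∑ x, p x * Real.exp (- h x) := by
    rw [Finset.mul_sum]
    refine Finset.sum_congr rfl fun x _ => ?_
    rw [show -1 * (h x - e) = e + - h x by ring, Real.exp_add]; ring
  rw [h2] at h1
  have hpos : 0 < ∑ x, p x * Real.exp (- h x) := by
    have hnn : ∀ x ∈ (Finset.univ : Finset X), 0 ≤ p x * Real.exp (- h x) :=
      fun x _ => mul_nonneg (hp.1 x) (Real.exp_pos _).le
    refine (Finset.sum_nonneg hnn).lt_of_ne fun h0 => ?_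
    have h3 := (Finset.sum_eq_zero_iff_of_nonneg hnn).1 h0.symm
    have h4 : ∑ x, p x = 0 := Finset.sum_eq_zero fun x hx => by
      simpa [Real.exp_ne_zero] using h3 x hx
    rw [hp.2] at h4; exact one_ne_zero h4
  have h5 := Real.log_le_log (mul_pos (Real.exp_pos e) hpos) h1
  rw [Real.log_mul (Real.exp_ne_zero _) hpos.ne', Real.log_exp, Real.log_exp] at h5
  refine h5.trans (le_of_eq ?_)
  push_cast
  rw [Real.norm_eq_abs, div_pow, sq_abs]
  ring

lemma aux_Z_pos {X : Type*} [Fintype X] [Nonempty X] (μ g : X → ℝ) (hμ : ∀ x, 0 < μ x) :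
    0 < ∑ y, μ y * Real.exp (g y) :=
  Finset.sum_pos (fun x _ => mul_pos (hμ x) (Real.exp_pos _)) Finset.univ_nonempty

lemma aux_gibbs_pos {X : Type*} [Fintype X] [Nonempty X] (μ g : X → ℝ) (hμ : ∀ x, 0 < μ x)
    (x : X) : 0 < gibbs μ g x :=
  div_pos (mul_pos (hμ x) (Real.exp_pos _)) (aux_Z_pos μ g hμ)

lemma aux_gibbs_prob {X : Type*} [Fintype X] [Nonempty X] (μ g : X → ℝ) (hμ : ∀ x, 0 < μ x) :
    IsProb (gibbs μ g) := by
  refine ⟨fun x => (aux_gibbs_pos μ g hμ x).le, ?_⟩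
  simp only [gibbs]
  rw [← Finset.sum_div, div_self (aux_Z_pos μ g hμ).ne']

lemma aux_kl_gibbs {X : Type*} [Fintype X] [Nonempty X] (μ g : X → ℝ) (hμ : ∀ x, 0 < μ x)
    (ν : X → ℝ) (hν : IsProb ν) :
    klDiv ν (gibbs μ g) = klDiv ν μ - ∑ x, ν x * g x + Real.log (∑ y, μ y * Real.exp (g y)) := by
  have hZ := aux_Z_pos μ g hμ
  set Z := ∑ y, μ y * Real.exp (g y) with hZd
  have : Real.log Z = ∑ x, ν x * Real.log Z := by rw [← Finset.sum_mul, hν.2, one_mul]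
  rw [this]
  simp only [klDiv]
  rw [← Finset.sum_sub_distrib, ← Finset.sum_add_distrib]
  refine Finset.sum_congr rfl fun x _ => ?_
  by_cases h0 : ν x = 0
  · simp [h0]
  have hg : gibbs μ g x = μ x * Real.exp (g x) / Z := rfl
  rw [hg, Real.log_div h0 (by have := hμ x; positivity), Real.log_div h0 (hμ x).ne',
    Real.log_div (by have := hμ x; positivity) hZ.ne',
    Real.log_mul (hμ x).ne' (Real.exp_ne_zero _), Real.log_exp]
  ring

lemma aux_kl_self {X : Type*} [Fintype X] (μ : X → ℝ) : klDiv μ μ = 0 := by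
  refine Finset.sum_eq_zero fun x _ => ?_
  by_cases h0 : μ x = 0
  · simp [h0]
  · simp [div_self h0]

lemma aux_kl_nonneg {X : Type*} [Fintype X] (ν ρ : X → ℝ) (hν : IsProb ν) (hρ : IsProb ρ)
    (hpos : ∀ x, 0 < ρ x) : 0 ≤ klDiv ν ρ := by
  have : ∀ x ∈ (Finset.univ : Finset X), ν x - ρ x ≤ ν x * Real.log (ν x / ρ x) := by
    intro x _
    rcases (hν.1 x).eq_or_lt with h0 | h0
    · simp [← h0, (hpos x).le]
    · have h1 := Real.log_le_sub_one_of_pos (div_pos (hpos x) h0)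
      have h2 : Real.log (ν x / ρ x) = - Real.log (ρ x / ν x) := by
        rw [← Real.log_inv, inv_div]
      rw [h2]
      have h3 := mul_le_mul_of_nonneg_left h1 h0.le
      have h4 : ν x * (ρ x / ν x - 1) = ρ x - ν x := by field_simp
      linarith
  have h := Finset.sum_le_sum this
  rw [Finset.sum_sub_distrib, hν.2, hρ.2, sub_self] at h
  exact h

lemma aux_gibbs_gibbs {X : Type*} [Fintype X] [Nonempty X] (μ g h : X → ℝ) (hμ : ∀ x, 0 < μ x) :
    gibbs (gibbs μ g) h = gibbs μ (fun x => g x + h x) := by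
  have hZ := aux_Z_pos μ g hμ
  funext x
  simp only [gibbs]
  have e : ∀ y, μ y * Real.exp (g y) / (∑ y, μ y * Real.exp (g y)) * Real.exp (h y)
      = μ y * Real.exp (g y + h y) / (∑ y, μ y * Real.exp (g y)) := by
    intro y; rw [Real.exp_add]; ring
  simp only [e]
  rw [← Finset.sum_div, div_div_div_cancel_right₀ hZ.ne']

lemma aux_drift {X : Type*} [Fintype X] [Nonempty X] (μ g g' : X → ℝ) (hμ : ∀ x, 0 < μ x)
    (a : ℝ) (ha : ∀ x, |g x - g' x| ≤ a) :
    klDiv (gibbs μ g) (gibbs μ g') ≤ a ^ 2 / 2 := by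
  have h1 : gibbs μ g' = gibbs (gibbs μ g) (fun x => - (g x - g' x)) := by
    rw [aux_gibbs_gibbs μ g _ hμ]; congr 1; funext x; ring
  have hp := aux_gibbs_prob μ g hμ
  rw [h1, aux_kl_gibbs _ _ (aux_gibbs_pos μ g hμ) _ hp, aux_kl_self]
  have := aux_hoeffding (gibbs μ g) (fun x => g x - g' x) hp a ha
  simp only [mul_neg, Finset.sum_neg_distrib]
  linarith

lemma aux_log_step (T : ℕ) : 1 / ((T : ℝ) + 2) ≤ Real.log ((T : ℝ) + 2) - Real.log ((T : ℝ) + 1) := by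
  have h1 : (0:ℝ) < (T:ℝ) + 1 := by positivity
  have h2 : (0:ℝ) < (T:ℝ) + 2 := by positivity
  have h := Real.log_le_sub_one_of_pos (div_pos h1 h2)
  rw [Real.log_div h1.ne' h2.ne'] at h
  have : ((T:ℝ) + 1) / (T + 2) - 1 = - (1 / ((T:ℝ) + 2)) := by field_simp; ring
  linarith

/-- the telescoped regret bound for an abstract finite space -/
lemma aux_regret {X : Type*} [Fintype X] [Nonempty X] (μ : X → ℝ) (hμ : ∀ x, 0 < μ x)
    (hμ1 : ∑ x, μ x = 1) (β M : ℝ) (hβ : 0 < β) (f F : ℕ → X → ℝ)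
    (hM : ∀ t x, |f t x| ≤ M)
    (hF : ∀ t x, F t x = (1 / ((t : ℝ) + 1)) * ∑ s ∈ Finset.Icc 1 t, f s x)
    (p : ℕ → X → ℝ) (hp : ∀ t, p t = gibbs μ (fun x => -β * F t x))
    (ν : X → ℝ) (hν : IsProb ν) (T : ℕ) :
    (∑ t ∈ Finset.Icc 1 T, (β * (∑ x, p (t - 1) x * f t x) + klDiv (p (t - 1)) μ))
      - (∑ t ∈ Finset.Icc 1 T, (β * (∑ x, ν x * f t x) + klDiv ν μ))
      ≤ 2 * (β * M) ^ 2 * Real.log ((T : ℝ) + 1) + klDiv ν μ := by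
  let Z : ℕ → ℝ := fun t => ∑ y, μ y * Real.exp (-β * F t y)
  have hpp : ∀ t, IsProb (p t) := fun t => by rw [hp]; exact aux_gibbs_prob _ _ hμ
  have hppos : ∀ t x, 0 < p t x := fun t x => by rw [hp]; exact aux_gibbs_pos _ _ hμ x
  have hM0 : 0 ≤ M := (abs_nonneg _).trans (hM 0 (Classical.arbitrary X))
  have hrec : ∀ (t : ℕ) x, ((t:ℝ) + 2) * F (t+1) x = ((t:ℝ) + 1) * F t x + f (t+1) x := by
    intro t x
    rw [hF, hF, Finset.sum_Icc_succ_top (by omega)]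
    push_cast
    field_simp
    ring
  have hFM : ∀ t x, |F t x| ≤ M := by
    intro t x
    rw [hF, abs_mul, abs_of_pos (by positivity : (0:ℝ) < 1 / ((t:ℝ)+1)), one_div_mul_eq_div,
      div_le_iff₀ (by positivity)]
    calc |∑ s ∈ Finset.Icc 1 t, f s x| ≤ ∑ s ∈ Finset.Icc 1 t, |f s x| :=
          Finset.abs_sum_le_sum_abs _ _
      _ ≤ ∑ s ∈ Finset.Icc 1 t, M := Finset.sum_le_sum fun s _ => hM s x
      _ = t * M := by simp
      _ ≤ M * (t + 1) := by linarith
  have hL : ∀ (t : ℕ) (ρ : X → ℝ), IsProb ρ →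
      klDiv ρ (p t) = klDiv ρ μ + β * (∑ x, ρ x * F t x) + Real.log (Z t) := by
    intro t ρ hρ
    rw [hp, aux_kl_gibbs _ _ hμ _ hρ]
    have : ∑ x, ρ x * (-β * F t x) = - (β * ∑ x, ρ x * F t x) := by
      rw [Finset.mul_sum, ← Finset.sum_neg_distrib]
      exact Finset.sum_congr rfl fun x _ => by ring
    rw [this]; ring
  have hrecs : ∀ (t : ℕ) (ρ : X → ℝ), ∑ x, ρ x * f (t+1) x
      = ((t:ℝ) + 2) * (∑ x, ρ x * F (t+1) x) - ((t:ℝ) + 1) * (∑ x, ρ x * F t x) := by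
    intro t ρ
    rw [Finset.mul_sum, Finset.mul_sum, ← Finset.sum_sub_distrib]
    exact Finset.sum_congr rfl fun x _ => by linear_combination (- ρ x) * hrec t x
  have hstep : ∀ t : ℕ, klDiv (p t) (p (t+1)) ≤ 2 * (β * M / ((t:ℝ) + 2)) ^ 2 := by
    intro t
    have h2 : (0:ℝ) < (t:ℝ) + 2 := by positivity
    have := aux_drift μ (fun x => -β * F t x) (fun x => -β * F (t+1) x) hμ
      (2 * (β * M) / ((t:ℝ) + 2)) (by
        intro x
        have e : -β * F t x - -β * F (t+1) x = β * (f (t+1) x - F t x) / ((t:ℝ)+2) := by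
          rw [eq_div_iff h2.ne']; linear_combination β * hrec t x
        rw [e, abs_div, abs_mul, abs_of_pos hβ, abs_of_pos h2]
        refine div_le_div_of_nonneg_right ?_ h2.le
        have := (abs_sub (f (t+1) x) (F t x)).trans (add_le_add (hM (t+1) x) (hFM t x))
        calc β * |f (t+1) x - F t x| ≤ β * (M + M) := mul_le_mul_of_nonneg_left this hβ.le
          _ = 2 * (β * M) := by ring)
    rw [hp t, hp (t+1)]
    refine this.trans (le_of_eq ?_)
    ring
  have hF0 : ∀ x, F 0 x = 0 := fun x => by rw [hF]; simp
  have hZ0 : Real.log (Z 0) = 0 := by simp [Z, hF0, hμ1]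
  have hA : ∀ T : ℕ, (∑ t ∈ Finset.Icc 1 T, (β * (∑ x, p (t - 1) x * f t x) + klDiv (p (t - 1)) μ))
      ≤ 2 * (β * M) ^ 2 * Real.log ((T : ℝ) + 1) - ((T:ℝ) + 1) * Real.log (Z T) := by
    intro T
    induction T with
    | zero => simp [hZ0]
    | succ T ih =>
      rw [Finset.sum_Icc_succ_top (by omega), Nat.add_sub_cancel, hrecs]
      have e1 := hL T (p T) (hpp T)
      rw [aux_kl_self] at e1
      have e2 := hL (T+1) (p T) (hpp T)
      have h2 : (0:ℝ) < (T:ℝ) + 2 := by positivity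
      have e3 := mul_le_mul_of_nonneg_left (hstep T) h2.le
      have e4 : ((T:ℝ) + 2) * (2 * (β * M / ((T:ℝ) + 2)) ^ 2)
          = 2 * (β * M) ^ 2 * (1 / ((T:ℝ) + 2)) := by field_simp
      have e5 := mul_le_mul_of_nonneg_left (aux_log_step T) (by positivity : 0 ≤ 2 * (β * M) ^ 2)
      rw [e2, e4] at e3
      push_cast
      rw [show (T:ℝ) + 1 + 1 = (T:ℝ) + 2 by ring]
      linear_combination ih + e3 + e5 + ((T:ℝ) + 1) * e1
  have hB : ∀ T : ℕ, (∑ t ∈ Finset.Icc 1 T, (β * (∑ x, ν x * f t x) + klDiv ν μ)) + klDiv ν μ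
      = ((T:ℝ) + 1) * (klDiv ν (p T) - Real.log (Z T)) := by
    intro T
    induction T with
    | zero => rw [hL 0 ν hν]; simp [hF0]
    | succ T ih =>
      rw [Finset.sum_Icc_succ_top (by omega), hrecs]
      rw [hL T ν hν] at ih
      rw [hL (T+1) ν hν]
      push_cast
      linear_combination ih
  have h1 := hA T
  have h2 := hB T
  have h3 := mul_nonneg (by positivity : (0:ℝ) ≤ (T:ℝ) + 1)
    (aux_kl_nonneg ν (p T) hν (hpp T) (hppos T))
  linarith

/-- Centralized regret bound:
`∑ ℓ_t(p_t) − ∑ ℓ_t(ν) ≤ 2(β|V|(Δ+1))² ln(T+1) + |V| ln(1/θ)`. -/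
theorem centralized_regret_bound
    (V : Type*) [Fintype V] [Nonempty V] [LinearOrder V]
    (G : SimpleGraph V) [DecidableRel G.Adj]
    (q : ℕ) [NeZero q]
    (μv : V → Fin q → ℝ) (hμpos : ∀ v a, 0 < μv v a) (hμsum : ∀ v, ∑ a, μv v a = 1)
    (μ₀ : (V → Fin q) → ℝ) (hμ₀ : ∀ x, μ₀ x = ∏ v, μv v (x v))
    (β : ℝ) (hβ : 0 < β)
    (φ : ℕ → V → Fin q → ℝ) (hφ : ∀ s v a, φ s v a ∈ Set.Icc (-1 : ℝ) 1)
    (ψ : ℕ → V → V → Fin q → Fin q → ℝ) (hψ : ∀ s u v a b, ψ s u v a b ∈ Set.Icc (-1 : ℝ) 1)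
    (f : ℕ → (V → Fin q) → ℝ)
    (hf : ∀ s x, f s x = (∑ v, φ s v (x v)) +
      ∑ u, ∑ v ∈ Finset.univ.filter (fun v => u < v ∧ G.Adj u v), ψ s u v (x u) (x v))
    (F : ℕ → (V → Fin q) → ℝ)
    (hF : ∀ t x, F t x = (1 / ((t : ℝ) + 1)) * ∑ s ∈ Finset.Icc 1 t, f s x)
    (p : ℕ → (V → Fin q) → ℝ)
    (hp : ∀ t : ℕ, 1 ≤ t → p t = gibbs μ₀ (fun x => -β * F (t - 1) x))
    (ℓ : ℕ → ((V → Fin q) → ℝ) → ℝ)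
    (hℓ : ∀ t ν, ℓ t ν = β * (∑ x, ν x * f t x) + klDiv ν μ₀)
    (θ : ℝ) (hθ : θ = ⨅ v, ⨅ a, μv v a)
    (T : ℕ) (hT : 1 ≤ T) :
    ∀ ν : (V → Fin q) → ℝ, IsProb ν →
      (∑ t ∈ Finset.Icc 1 T, ℓ t (p t)) - (∑ t ∈ Finset.Icc 1 T, ℓ t ν) ≤
        2 * (β * (Fintype.card V) * ((G.maxDegree : ℝ) + 1)) ^ 2 * Real.log ((T : ℝ) + 1)
          + (Fintype.card V) * Real.log (1 / θ) := by
  intro ν hν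
  have hμ : ∀ x, 0 < μ₀ x := fun x => by rw [hμ₀]; exact Finset.prod_pos fun v _ => hμpos v _
  have hμ1 : ∑ x, μ₀ x = 1 := by
    simp only [hμ₀]
    rw [← Fintype.prod_sum]
    simp [hμsum]
  have hM : ∀ t x, |f t x| ≤ (Fintype.card V : ℝ) * ((G.maxDegree : ℝ) + 1) := by
    intro t x
    rw [hf]
    have h1 : |∑ v, φ t v (x v)| ≤ (Fintype.card V : ℝ) := by
      calc |∑ v, φ t v (x v)| ≤ ∑ v, |φ t v (x v)| := Finset.abs_sum_le_sum_abs _ _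
        _ ≤ ∑ v : V, (1:ℝ) := Finset.sum_le_sum fun v _ => abs_le.2 (hφ t v _)
        _ = _ := by simp
    have h2 : |∑ u, ∑ v ∈ Finset.univ.filter (fun v => u < v ∧ G.Adj u v), ψ t u v (x u) (x v)|
        ≤ (Fintype.card V : ℝ) * (G.maxDegree : ℝ) := by
      calc _ ≤ ∑ u, |∑ v ∈ Finset.univ.filter (fun v => u < v ∧ G.Adj u v), ψ t u v (x u) (x v)| :=
            Finset.abs_sum_le_sum_abs _ _
        _ ≤ ∑ u : V, (G.maxDegree : ℝ) := Finset.sum_le_sum fun u _ => by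
            calc _ ≤ ∑ v ∈ Finset.univ.filter (fun v => u < v ∧ G.Adj u v),
                  |ψ t u v (x u) (x v)| := Finset.abs_sum_le_sum_abs _ _
              _ ≤ ∑ v ∈ Finset.univ.filter (fun v => u < v ∧ G.Adj u v), (1:ℝ) :=
                  Finset.sum_le_sum fun v _ => abs_le.2 (hψ t u v _ _)
              _ = ((Finset.univ.filter (fun v => u < v ∧ G.Adj u v)).card : ℝ) := by simp
              _ ≤ (G.degree u : ℝ) := by
                  rw [← SimpleGraph.card_neighborFinset_eq_degree]
                  refine Nat.cast_le.2 (Finset.card_le_card fun v hv => ?_)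
                  simp only [Finset.mem_filter] at hv
                  simpa using hv.2.2
              _ ≤ (G.maxDegree : ℝ) := Nat.cast_le.2 (G.degree_le_maxDegree u)
        _ = _ := by simp
    have h3 := abs_add_le (∑ v, φ t v (x v))
      (∑ u, ∑ v ∈ Finset.univ.filter (fun v => u < v ∧ G.Adj u v), ψ t u v (x u) (x v))
    linarith
  have hθle : ∀ v a, θ ≤ μv v a := fun v a => by
    rw [hθ]
    exact (ciInf_le (Set.finite_range _).bddBelow v).trans
      (ciInf_le (Set.finite_range _).bddBelow a)
  have hθpos : 0 < θ := by
    obtain ⟨v, hv⟩ := exists_eq_ciInf_of_finite (f := fun v => ⨅ a, μv v a)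
    obtain ⟨a, ha⟩ := exists_eq_ciInf_of_finite (f := fun a => μv v a)
    rw [hθ, ← hv, ← ha]
    exact hμpos v a
  have hD : klDiv ν μ₀ ≤ (Fintype.card V) * Real.log (1 / θ) := by
    have hν1 : ∀ x, ν x ≤ 1 := fun x => by
      rw [← hν.2]; exact Finset.single_le_sum (fun y _ => hν.1 y) (Finset.mem_univ x)
    calc klDiv ν μ₀ ≤ ∑ x, ν x * ((Fintype.card V) * Real.log (1 / θ)) := by
          refine Finset.sum_le_sum fun x _ => ?_
          rcases (hν.1 x).eq_or_lt with h0 | h0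
          · simp [← h0]
          refine mul_le_mul_of_nonneg_left ?_ h0.le
          rw [Real.log_div h0.ne' (hμ x).ne', hμ₀, Real.log_prod (fun v _ => (hμpos v _).ne'),
            one_div, Real.log_inv]
          have h1 : ∑ v : V, Real.log θ ≤ ∑ v, Real.log (μv v (x v)) :=
            Finset.sum_le_sum fun v _ => Real.log_le_log hθpos (hθle v _)
          have h2 := Real.log_nonpos h0.le (hν1 x)
          simp only [Finset.sum_const, Finset.card_univ, nsmul_eq_mul] at h1
          linarith
      _ = _ := by rw [← Finset.sum_mul, hν.2, one_mul]
  have key := aux_regret μ₀ hμ hμ1 β _ hβ f F hM hF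
    (fun t => gibbs μ₀ (fun x => -β * F t x)) (fun _ => rfl) ν hν T
  have e1 : ∑ t ∈ Finset.Icc 1 T, ℓ t (p t) = ∑ t ∈ Finset.Icc 1 T,
      (β * (∑ x, gibbs μ₀ (fun x => -β * F (t - 1) x) x * f t x)
        + klDiv (gibbs μ₀ (fun x => -β * F (t - 1) x)) μ₀) :=
    Finset.sum_congr rfl fun t ht => by rw [hℓ, hp t (Finset.mem_Icc.1 ht).1]
  have e2 : ∑ t ∈ Finset.Icc 1 T, ℓ t ν = ∑ t ∈ Finset.Icc 1 T,
      (β * (∑ x, ν x * f t x) + klDiv ν μ₀) :=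
    Finset.sum_congr rfl fun t _ => hℓ t ν
  rw [e1, e2, mul_assoc β]
  exact key.trans (by gcongr)
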